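/- For any a, b ∈ ℝ with (a,b) ≠ (0,0), the reflection across the line au + bv = 0 in ℝ² is an isometry of the Gans metric h. -/

import Mathlib

/-- The Gans metric on ℝ² as a bilinear form at each point. -/
noncomputable def gansBil (p : ℝ × ℝ) (X Y : ℝ × ℝ) : ℝ :=
  ((1 + p.2 ^ 2) * X.1 * Y.1 - p.1 * p.2 * (X.1 * Y.2 + X.2 * Y.1)
    + (1 + p.1 ^ 2) * X.2 * Y.2) / (1 + p.1 ^ 2 + p.2 ^ 2)

/-- The (Euclidean) reflection of ℝ² across the line a·u + b·v = 0. -/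
noncomputable def lineReflection (a b : ℝ) (p : ℝ × ℝ) : ℝ × ℝ :=
  (((b ^ 2 - a ^ 2) * p.1 - 2 * a * b * p.2) / (a ^ 2 + b ^ 2),
   (-(2 * a * b) * p.1 + (a ^ 2 - b ^ 2) * p.2) / (a ^ 2 + b ^ 2))

/-- The reflection across any line a·u + b·v = 0 through the origin is an
isometry of the Gans metric. -/
theorem lineReflection_isometry_of_gans (a b : ℝ) (hab : (a, b) ≠ (0, 0)) :
    ∀ p X Y : ℝ × ℝ,
      gansBil (lineReflection a b p) (lineReflection a b X) (lineReflection a b Y)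
        = gansBil p X Y := by
  rintro ⟨u, v⟩ ⟨x, y⟩ ⟨z, w⟩
  have hn : a ^ 2 + b ^ 2 ≠ 0 := by
    intro h
    apply hab
    have ha : a = 0 := by nlinarith [sq_nonneg a, sq_nonneg b]
    have hb : b = 0 := by nlinarith [sq_nonneg a, sq_nonneg b]
    rw [ha, hb]
  obtain ⟨c, hc⟩ : ∃ c, c = (b ^ 2 - a ^ 2) / (a ^ 2 + b ^ 2) := ⟨_, rfl⟩
  obtain ⟨s, hs⟩ : ∃ s, s = 2 * a * b / (a ^ 2 + b ^ 2) := ⟨_, rfl⟩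
  have h1 : c ^ 2 + s ^ 2 = 1 := by
    rw [hc, hs]
    field_simp
    ring
  have key : ∀ p q : ℝ, lineReflection a b (p, q) = (c * p - s * q, -s * p - c * q) := by
    intro p q
    rw [hc, hs]
    unfold lineReflection
    ext
    · simp only
      ring
    · simp only
      ring
  rw [key, key, key]
  unfold gansBil
  simp only
  congr 1
  · have e : ∀ u v x y z w : ℝ, (1 + v ^ 2) * x * z - u * v * (x * w + y * z)
        + (1 + u ^ 2) * y * w = (x * z + y * w) + (u * y - v * x) * (u * w - v * z) := by
      intros
      ring
    rw [e, e]
    have d : (c * x - s * y) * (c * z - s * w) + (-s * x - c * y) * (-s * z - c * w)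
        = x * z + y * w := by
      linear_combination (x * z + y * w) * h1
    have f : ∀ x y : ℝ, (c * u - s * v) * (-s * x - c * y) - (-s * u - c * v) * (c * x - s * y)
        = -(u * y - v * x) := by
      intro x y
      linear_combination -(u * y - v * x) * h1
    rw [d, f, f]
    ring
  · linear_combination (u ^ 2 + v ^ 2) * h1
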